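/- Every graph on n vertices (n ≥ 1) has at most F(n+1) − 1 matching cuts. -/

import Mathlib

namespace MatchingCutPaper

/-- The set of edges of `G` with one endpoint in `A` and the other endpoint outside `A`. -/
def cutEdges {V : Type} (G : SimpleGraph V) (A : Set V) : Set (Sym2 V) :=
  {e | e ∈ G.edgeSet ∧ ∃ u v : V, e = s(u, v) ∧ u ∈ A ∧ v ∉ A}

/-- `M` is a matching of `G`: a set of edges of `G`, no two of which share an endpoint. -/
def IsMatchingSet {V : Type} (G : SimpleGraph V) (M : Set (Sym2 V)) : Prop :=
  M ⊆ G.edgeSet ∧ ∀ e ∈ M, ∀ f ∈ M, e ≠ f → ∀ v : V, ¬(v ∈ e ∧ v ∈ f)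

/-- `M` is a matching cut of `G`: a matching of the form `E(A, B)` for a partition `{A, B}`
of the vertex set into two nonempty parts. -/
def IsMatchingCut {V : Type} (G : SimpleGraph V) (M : Set (Sym2 V)) : Prop :=
  IsMatchingSet G M ∧ ∃ A : Set V, A.Nonempty ∧ Aᶜ.Nonempty ∧ M = cutEdges G A

/-- A matching cut is minimal if no proper subset of it is a matching cut. -/
def IsMinimalMatchingCut {V : Type} (G : SimpleGraph V) (M : Set (Sym2 V)) : Prop :=
  IsMatchingCut G M ∧ ∀ M' : Set (Sym2 V), M' ⊂ M → ¬ IsMatchingCut G M'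

/-- A matching cut is maximal if no proper superset of it is a matching cut. -/
def IsMaximalMatchingCut {V : Type} (G : SimpleGraph V) (M : Set (Sym2 V)) : Prop :=
  IsMatchingCut G M ∧ ∀ M' : Set (Sym2 V), M ⊂ M' → ¬ IsMatchingCut G M'

theorem IsMatchingSet.subset {V : Type} {G H : SimpleGraph V} {M N : Set (Sym2 V)}
    (hM : IsMatchingSet G M) (hNM : N ⊆ M) (hN : N ⊆ H.edgeSet) : IsMatchingSet H N :=
  ⟨hN, fun e he f hf => hM.2 e (hNM he) f (hNM hf)⟩

/-- A finite acyclic graph with an edge has a leaf. -/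
theorem exists_leaf_of_isAcyclic {V : Type} [Finite V] {H : SimpleGraph V}
    (hH : H.IsAcyclic) {a b : V} (hab : H.Adj a b) :
    ∃ u v, H.Adj v u ∧ ∀ w, H.Adj v w → w = u := by
  have : Nonempty V := ⟨a⟩
  obtain ⟨x, y, p, hp, hmax⟩ := SimpleGraph.Walk.exists_isPath_forall_isPath_length_le_length H
  have hpos := hmax a b hab.toWalk (by simp [SimpleGraph.Walk.cons_isPath_iff, hab.ne])
  have hnil : ¬ p.Nil := by
    rw [← SimpleGraph.Walk.length_eq_zero_iff]
    simp at hpos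
    omega
  refine ⟨p.snd, x, p.adj_snd hnil, fun w hw => ?_⟩
  by_cases hwp : w ∈ p.support
  · exact hH.eq_snd_of_adj_start hp hw hwp
  · have hlong := hmax w y (.cons hw.symm p) (hp.cons hwp)
    rw [SimpleGraph.Walk.length_cons] at hlong
    omega

/-- A forest whose edges lie inside a set of `n` vertices has at most `F(n + 1)` matchings. -/
theorem ncard_matchings_le_of_isAcyclic {V : Type} [Finite V] (n : ℕ) (H : SimpleGraph V)
    (hH : H.IsAcyclic) (S : Finset V) (hS : S.card = n) (hHS : ∀ a b, H.Adj a b → a ∈ S) :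
    {M | IsMatchingSet H M}.ncard ≤ Nat.fib (n + 1) := by
  classical
  induction n using Nat.strong_induction_on generalizing H S with
  | _ n ih =>
  by_cases hE : ∃ a b, H.Adj a b
  · obtain ⟨a, b, hab⟩ := hE
    obtain ⟨u, v, hvu, hv⟩ := exists_leaf_of_isAcyclic hH hab
    have hvS := hHS v u hvu
    have huS : u ∈ S.erase v := Finset.mem_erase.2 ⟨hvu.ne.symm, hHS u v hvu.symm⟩
    have hc1 := Finset.card_erase_add_one hvS
    have hc2 := Finset.card_erase_add_one huS
    obtain ⟨k, rfl⟩ : ∃ k, n = k + 2 := ⟨((S.erase v).erase u).card, by omega⟩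
    have h1 := ih (k + 1) (by omega) (H.deleteIncidenceSet v)
      (hH.anti (H.deleteIncidenceSet_le v)) (S.erase v) (by omega) (by
        intro a b h
        rw [SimpleGraph.deleteIncidenceSet_adj] at h
        exact Finset.mem_erase.2 ⟨h.2.1, hHS a b h.1⟩)
    have h2 := ih k (by omega) ((H.deleteIncidenceSet v).deleteIncidenceSet u)
      (hH.anti ((SimpleGraph.deleteIncidenceSet_le _ u).trans (H.deleteIncidenceSet_le v)))
      ((S.erase v).erase u) (by omega) (by
        intro a b h
        rw [SimpleGraph.deleteIncidenceSet_adj, SimpleGraph.deleteIncidenceSet_adj] at h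
        exact Finset.mem_erase.2 ⟨h.2.1, Finset.mem_erase.2 ⟨h.1.2.1, hHS a b h.1.1⟩⟩)
    have hsub : {M | IsMatchingSet H M} ⊆ {M | IsMatchingSet (H.deleteIncidenceSet v) M} ∪
        insert s(v, u) '' {M | IsMatchingSet ((H.deleteIncidenceSet v).deleteIncidenceSet u) M} := by
      intro M hM
      by_cases he : s(v, u) ∈ M
      · refine Or.inr ⟨M \ {s(v, u)}, hM.subset Set.sdiff_subset ?_, by simp [he]⟩
        intro f hf
        have hfe : s(v, u) ≠ f := fun h => hf.2 h.symm
        have hfv := hM.2 _ he f hf.1 hfe v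
        have hfu := hM.2 _ he f hf.1 hfe u
        have hfH := hM.1 hf.1
        induction f with | _ x y =>
        simp only [SimpleGraph.mem_edgeSet, SimpleGraph.deleteIncidenceSet_adj, Sym2.mem_iff]
          at hfv hfu hfH ⊢
        grind
      · refine Or.inl (hM.subset subset_rfl ?_)
        intro f hf
        have hfH := hM.1 hf
        have hfe : s(v, u) ≠ f := fun h => he (h ▸ hf)
        induction f with | _ x y =>
        simp only [SimpleGraph.mem_edgeSet, SimpleGraph.deleteIncidenceSet_adj] at hfH ⊢
        refine ⟨hfH, ?_, ?_⟩
        · rintro rfl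
          exact hfe (by rw [hv y hfH])
        · rintro rfl
          exact hfe (by rw [hv x hfH.symm, Sym2.eq_swap])
    have h3 := Set.ncard_le_ncard hsub (Set.toFinite _)
    have h4 := Set.ncard_union_le {M | IsMatchingSet (H.deleteIncidenceSet v) M}
      (insert s(v, u) '' {M | IsMatchingSet ((H.deleteIncidenceSet v).deleteIncidenceSet u) M})
    have h5 := Set.ncard_image_le (f := insert s(v, u))
      (Set.toFinite {M | IsMatchingSet ((H.deleteIncidenceSet v).deleteIncidenceSet u) M})
    have h6 : Nat.fib (k + 2 + 1) = Nat.fib (k + 1) + Nat.fib (k + 1 + 1) := Nat.fib_add_two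
    omega
  · have hsub : {M | IsMatchingSet H M} ⊆ {∅} := by
      intro M hM
      refine Set.eq_empty_iff_forall_notMem.2 fun e he => hE ?_
      have := hM.1 he
      induction e with | _ x y => exact ⟨x, y, this⟩
    have h1 := Set.ncard_le_ncard hsub (Set.toFinite _)
    rw [Set.ncard_singleton] at h1
    exact h1.trans (Nat.fib_pos.2 (by omega))

theorem mk_mem_cutEdges {V : Type} {G : SimpleGraph V} {A : Set V} {x y : V} :
    s(x, y) ∈ cutEdges G A ↔ G.Adj x y ∧ ¬(x ∈ A ↔ y ∈ A) := by
  simp only [cutEdges, Set.mem_ofPred_eq, SimpleGraph.mem_edgeSet, Sym2.eq_iff]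
  grind

/-- A cut of `G` is determined by its edges in a subgraph with the same reachability relation. -/
theorem cutEdges_inter_injective {V : Type} {G F : SimpleGraph V} (hle : F ≤ G)
    (hr : F.Reachable = G.Reachable) {A B : Set V}
    (h : cutEdges G A ∩ F.edgeSet = cutEdges G B ∩ F.edgeSet) : cutEdges G A = cutEdges G B := by
  have hadj : ∀ x y, F.Adj x y → ((x ∈ A ↔ y ∈ A) ↔ (x ∈ B ↔ y ∈ B)) := by
    intro x y hxy
    have := Set.ext_iff.1 h s(x, y)
    simp only [Set.mem_inter_iff, mk_mem_cutEdges, SimpleGraph.mem_edgeSet] at this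
    have := hle hxy
    tauto
  have hreach : ∀ x y, F.Reachable x y → ((x ∈ A ↔ y ∈ A) ↔ (x ∈ B ↔ y ∈ B)) := by
    rintro x y ⟨p⟩
    induction p with
    | nil => simp
    | cons hxy p ih =>
      have := hadj _ _ hxy
      tauto
  ext e
  induction e with | _ x y =>
  rw [mk_mem_cutEdges, mk_mem_cutEdges]
  refine and_congr_right fun hxy => not_congr (hreach x y ?_)
  rw [hr]
  exact hxy.reachable

/-- In a connected graph, every cut between two nonempty parts is nonempty. -/
theorem cutEdges_nonempty {V : Type} {G : SimpleGraph V} (hG : G.Preconnected) {A : Set V}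
    (hA : A.Nonempty) (hA' : Aᶜ.Nonempty) : (cutEdges G A).Nonempty := by
  obtain ⟨a, ha⟩ := hA
  obtain ⟨b, hb⟩ := hA'
  obtain ⟨p⟩ := hG a b
  obtain ⟨d, -, hd, hd'⟩ := p.exists_boundary_dart A ha hb
  exact ⟨s(d.fst, d.snd), mk_mem_cutEdges.2 ⟨d.adj, by tauto⟩⟩

/-- Every graph on `n ≥ 1` vertices has at most `F(n + 1) - 1` matching cuts. -/
theorem card_matchingCuts_le {V : Type} [Fintype V] (n : ℕ) (hn : 1 ≤ n)
    (G : SimpleGraph V) (hcard : Fintype.card V = n) :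
    Nat.card {M : Set (Sym2 V) // IsMatchingCut G M} ≤ Nat.fib (n + 1) - 1 := by
  classical
  obtain ⟨F, hFG, hF, hr⟩ := G.exists_isAcyclic_reachable_eq_le
  have hinj : Set.InjOn (fun M => M ∩ F.edgeSet) {M | IsMatchingCut G M} := by
    rintro _ ⟨-, A, -, -, rfl⟩ _ ⟨-, B, -, -, rfl⟩ h
    exact cutEdges_inter_injective hFG hr h
  obtain ⟨T, hT, hFT, N, hN, hNM⟩ : ∃ T : SimpleGraph V, T.IsAcyclic ∧ F ≤ T ∧
      ∃ N, IsMatchingSet T N ∧ ∀ M, IsMatchingCut G M → M ∩ F.edgeSet ≠ N := by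
    by_cases hG : G.Preconnected
    · refine ⟨F, hF, le_rfl, ∅, ⟨Set.empty_subset _, by simp⟩, ?_⟩
      rintro _ ⟨-, A, hA, hA', rfl⟩ h
      have hempty : cutEdges G (∅ : Set V) = ∅ := by simp [cutEdges]
      refine (cutEdges_nonempty hG hA hA').ne_empty ?_
      rw [← hempty]
      exact cutEdges_inter_injective hFG hr (by rw [h, hempty, Set.empty_inter])
    · simp only [SimpleGraph.Preconnected, not_forall] at hG
      obtain ⟨u, v, huv⟩ := hG
      have huv' : ¬ F.Reachable u v := by rwa [hr]
      have hne : u ≠ v := by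
        rintro rfl
        exact huv (SimpleGraph.Reachable.refl u)
      refine ⟨F ⊔ SimpleGraph.edge u v, hF.sup_edge_of_not_reachable huv', le_sup_left,
        {s(u, v)}, ⟨?_, ?_⟩, ?_⟩
      · simp [hne]
      · rintro e rfl f rfl h
        exact absurd rfl h
      · intro M _ h
        have : s(u, v) ∈ M ∩ F.edgeSet := h ▸ Set.mem_singleton _
        exact huv' (SimpleGraph.Adj.reachable this.2)
  have hsub : insert N ((fun M => M ∩ F.edgeSet) '' {M | IsMatchingCut G M}) ⊆
      {M | IsMatchingSet T M} := by
    rintro _ (rfl | ⟨M, hM, rfl⟩)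
    · exact hN
    · exact hM.1.subset Set.inter_subset_left
        (Set.inter_subset_right.trans (SimpleGraph.edgeSet_mono hFT))
  have h1 := Set.ncard_le_ncard hsub (Set.toFinite _)
  rw [Set.ncard_insert_of_notMem (by rintro ⟨M, hM, h⟩; exact hNM M hM h) (Set.toFinite _),
    hinj.ncard_image] at h1
  have h2 := ncard_matchings_le_of_isAcyclic n T hT Finset.univ hcard
    (fun _ _ _ => Finset.mem_univ _)
  have h3 : Nat.card {M : Set (Sym2 V) // IsMatchingCut G M} =
    {M | IsMatchingCut G M}.ncard := rfl
  omega

end MatchingCutPaper
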